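/- Let X be an uncountable subset of 2^ω. Then X is a Δ-set if and only if every vanishing sequence (F_n : n ∈ ℕ) of subsets of X admits a vanishing sequence (G_n : n ∈ ℕ) of relative G_δ subsets of X (countable intersections of relatively open subsets of X) with F_n ⊆ G_n for all n. -/

import Mathlib

/-- The Cantor space `2^ω`. -/
abbrev Cantor : Type := ℕ → Bool

/-- A sequence of sets is *vanishing* if it is decreasing and has empty intersection. -/
def Vanishing {α : Type*} (F : ℕ → Set α) : Prop :=
  (∀ n, F (n + 1) ⊆ F n) ∧ (⋂ n, F n) = ∅

/-- An uncountable subset `X` of a topological space is a *Δ-set* if every vanishing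
sequence of subsets of `X` admits a vanishing expansion by relatively open sets. -/
def IsDeltaSet {α : Type*} [TopologicalSpace α] (X : Set α) : Prop :=
  ¬ X.Countable ∧
    ∀ F : ℕ → Set X, Vanishing F →
      ∃ U : ℕ → Set X, (∀ n, IsOpen (U n)) ∧ Vanishing U ∧ ∀ n, F n ⊆ U n

/-- An uncountable `X ⊆ 2^ω` is a Δ-set iff every vanishing sequence of subsets of `X`
admits a vanishing expansion by relative Gδ subsets of `X`. -/
theorem isDeltaSet_iff_gdelta_expansion (X : Set Cantor) (hX : ¬ X.Countable) :
    IsDeltaSet X ↔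
      ∀ F : ℕ → Set X, Vanishing F →
        ∃ G : ℕ → Set X,
          (∀ n, ∃ V : ℕ → Set X, (∀ k, IsOpen (V k)) ∧ G n = ⋂ k, V k) ∧
          Vanishing G ∧ ∀ n, F n ⊆ G n := by
  constructor
  · rintro ⟨-, h⟩ F hF
    obtain ⟨U, hU, hv, hs⟩ := h F hF
    exact ⟨U, fun n => ⟨fun _ => U n, fun _ => hU n, (Set.iInter_const _).symm⟩, hv, hs⟩
  · intro h
    refine ⟨hX, fun F hF => ?_⟩
    obtain ⟨G, hG, hv, hs⟩ := h F hF
    choose V hV hGV using hG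
    have hanti : Antitone F := antitone_nat_of_succ_le hF.1
    -- intersect the first `n` open sets of each of the first `n` Gδ sets
    refine ⟨fun n => ⋂ i ∈ Set.Iic n, ⋂ k ∈ Set.Iic n, V i k, ?_, ⟨?_, ?_⟩, ?_⟩
    · intro n
      exact (Set.finite_Iic n).isOpen_biInter fun i _ =>
        (Set.finite_Iic n).isOpen_biInter fun k _ => hV i k
    · intro n x hx
      simp only [Set.mem_iInter, Set.mem_Iic] at hx ⊢
      exact fun i hi k hk => hx i (by omega) k (by omega)
    · rw [Set.eq_empty_iff_forall_notMem]
      intro x hx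
      have hxG : x ∈ ⋂ n, G n := by
        simp only [Set.mem_iInter, Set.mem_Iic] at hx ⊢
        intro i
        rw [hGV i, Set.mem_iInter]
        exact fun k => hx (max i k) i (le_max_left _ _) k (le_max_right _ _)
      rw [hv.2] at hxG
      exact hxG
    · intro n x hx
      simp only [Set.mem_iInter, Set.mem_Iic]
      intro i hi k _
      have hxi : x ∈ G i := hs i (hanti hi hx)
      rw [hGV i, Set.mem_iInter] at hxi
      exact hxi k
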